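/- Asymptotic curvature adjusted redistribution: if the tangential velocity α satisfies ∂_s(φ(k)α)/φ(k) = f/φ(k) − ⟨f⟩/⟨φ(k)⟩ + ω(t)(r_φ⁻¹ − 1), with f = φ(k) k β − (∂_s²β + k²β) φ'(k), the function ω is nonnegative, and ∫₀^t ω(τ) dτ → ∞ as t → T, then for every parameter value u the extended relative local length converges: r_φ(u,t) → 1 as t → T. -/

import Mathlib

noncomputable section

open Real Filter

/-- Time domain `[0, Tmax)`; the final time `Tmax ∈ (0, ∞]` is encoded as an `EReal`. -/
def timeDom (Tmax : EReal) : Set ℝ := {t : ℝ | 0 ≤ t ∧ (t : EReal) < Tmax}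

/-- The filter of times `t` approaching `Tmax` from below (equals `atTop` if `Tmax = ∞`). -/
def toTime (Tmax : EReal) : Filter ℝ :=
  Filter.comap (fun t : ℝ => (t : EReal)) (nhdsWithin Tmax (Set.Iio Tmax))

/-- Euclidean length of a plane vector. -/
def elen (v : ℝ × ℝ) : ℝ := Real.sqrt (v.1 ^ 2 + v.2 ^ 2)

/-- Rotation of a plane vector by `π/2`, taking the unit tangent to the unit inward
normal, so that `det (v, rot v) = |v|² ≥ 0`. -/
def rot (v : ℝ × ℝ) : ℝ × ℝ := (-v.2, v.1)

/-- Local length `g(u,t) = |∂_u x(u,t)|`. -/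
def gl (x : ℝ → ℝ → ℝ × ℝ) (u t : ℝ) : ℝ := elen (deriv (fun u' => x u' t) u)

/-- Unit tangent vector `T = ∂_s x = g⁻¹ ∂_u x`. -/
def tang (x : ℝ → ℝ → ℝ × ℝ) (u t : ℝ) : ℝ × ℝ :=
  (gl x u t)⁻¹ • deriv (fun u' => x u' t) u

/-- Unit inward normal vector `N = rot T`. -/
def nor (x : ℝ → ℝ → ℝ × ℝ) (u t : ℝ) : ℝ × ℝ := rot (tang x u t)

/-- Total length `L(t) = ∫₀¹ g(u,t) du`. -/
def len (x : ℝ → ℝ → ℝ × ℝ) (t : ℝ) : ℝ := ∫ u in (0:ℝ)..1, gl x u t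

/-- Arc-length average `⟨F⟩(t) = L(t)⁻¹ ∫₀¹ F g du`. -/
def avg (x : ℝ → ℝ → ℝ × ℝ) (F : ℝ → ℝ → ℝ) (t : ℝ) : ℝ :=
  (len x t)⁻¹ * ∫ u in (0:ℝ)..1, F u t * gl x u t

/-- Arc-length derivative `∂_s F = g⁻¹ ∂_u F` of a scalar quantity. -/
def sder (x : ℝ → ℝ → ℝ × ℝ) (F : ℝ → ℝ → ℝ) (u t : ℝ) : ℝ :=
  (gl x u t)⁻¹ * deriv (fun u' => F u' t) u

/-- The quantity `f = φ(k) k β − (∂_s²β + k²β) φ'(k)` from the redistribution equation. -/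
def fphi (x : ℝ → ℝ → ℝ × ℝ) (φ : ℝ → ℝ) (k β : ℝ → ℝ → ℝ) (u t : ℝ) : ℝ :=
  φ (k u t) * k u t * β u t
    - (sder x (sder x β) u t + (k u t) ^ 2 * β u t) * deriv φ (k u t)

/-- Extended relative local length `r_φ = g φ(k) / (L ⟨φ(k)⟩)`. -/
def rphi (x : ℝ → ℝ → ℝ × ℝ) (φ : ℝ → ℝ) (k : ℝ → ℝ → ℝ) (u t : ℝ) : ℝ :=
  gl x u t * φ (k u t) / (len x t * avg x (fun u' t' => φ (k u' t')) t)

section PartialDerivatives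

variable {E : Type*} [NormedAddCommGroup E] [NormedSpace ℝ E]

/-- Partial derivative in the spatial parameter. -/
def du (F : ℝ → ℝ → E) (u t : ℝ) : E := deriv (fun u' => F u' t) u

/-- Partial derivative in time. -/
def dt (F : ℝ → ℝ → E) (u t : ℝ) : E := deriv (fun t' => F u t') t

/-- Joint smoothness at every point of the strip `ℝ × I`. -/
def SmoothOnStrip (I : Set ℝ) (F : ℝ → ℝ → E) : Prop :=
  ∀ u : ℝ, ∀ t ∈ I, ContDiffAt ℝ (⊤ : ℕ∞) (Function.uncurry F) (u, t)

variable {I : Set ℝ} {F : ℝ → ℝ → E} {f h : ℝ → ℝ → ℝ} {u t : ℝ}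

lemma hasDerivAt_fst_of_contDiffAt (hF : ContDiffAt ℝ (⊤ : ℕ∞) (Function.uncurry F) (u, t)) :
    HasDerivAt (fun u' => F u' t) (fderiv ℝ (Function.uncurry F) (u, t) (1, 0)) u := by
  have h1 := (hF.differentiableAt (by simp)).hasFDerivAt
  exact h1.comp_hasDerivAt_of_eq (f := fun u' : ℝ => (u', t)) u
    ((hasDerivAt_id u).prodMk (hasDerivAt_const u t)) rfl

lemma hasDerivAt_snd_of_contDiffAt (hF : ContDiffAt ℝ (⊤ : ℕ∞) (Function.uncurry F) (u, t)) :
    HasDerivAt (fun t' => F u t') (fderiv ℝ (Function.uncurry F) (u, t) (0, 1)) t := by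
  have h1 := (hF.differentiableAt (by simp)).hasFDerivAt
  exact h1.comp_hasDerivAt_of_eq (f := fun t' : ℝ => (u, t')) t
    ((hasDerivAt_const t u).prodMk (hasDerivAt_id t)) rfl

lemma ContDiff.smoothOnStrip (hF : ContDiff ℝ (⊤ : ℕ∞) (Function.uncurry F)) :
    SmoothOnStrip I F := fun _ _ _ => hF.contDiffAt

namespace SmoothOnStrip

lemma hasDerivAt_du (hF : SmoothOnStrip I F) (ht : t ∈ I) :
    HasDerivAt (fun u' => F u' t) (du F u t) u :=
  (hasDerivAt_fst_of_contDiffAt (hF u t ht)).differentiableAt.hasDerivAt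

lemma hasDerivAt_dt (hF : SmoothOnStrip I F) (ht : t ∈ I) :
    HasDerivAt (fun t' => F u t') (dt F u t) t :=
  (hasDerivAt_snd_of_contDiffAt (hF u t ht)).differentiableAt.hasDerivAt

lemma eventually_mem (hI : IsOpen I) (ht : t ∈ I) :
    ∀ᶠ p : ℝ × ℝ in nhds (u, t), p.2 ∈ I :=
  continuousAt_snd.eventually_mem (hI.mem_nhds ht)

lemma du_eventuallyEq (hI : IsOpen I) (hF : SmoothOnStrip I F) (ht : t ∈ I) :
    Function.uncurry (du F) =ᶠ[nhds (u, t)] fun p => fderiv ℝ (Function.uncurry F) p (1, 0) := by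
  filter_upwards [eventually_mem hI ht] with p hp
  exact (hasDerivAt_fst_of_contDiffAt (hF p.1 p.2 hp)).deriv

lemma dt_eventuallyEq (hI : IsOpen I) (hF : SmoothOnStrip I F) (ht : t ∈ I) :
    Function.uncurry (dt F) =ᶠ[nhds (u, t)] fun p => fderiv ℝ (Function.uncurry F) p (0, 1) := by
  filter_upwards [eventually_mem hI ht] with p hp
  exact (hasDerivAt_snd_of_contDiffAt (hF p.1 p.2 hp)).deriv

lemma smooth_du (hF : SmoothOnStrip I F) (hI : IsOpen I) : SmoothOnStrip I (du F) :=
  fun u t ht => (((hF u t ht).fderiv_right (m := (⊤ : ℕ∞)) (by simp)).clm_apply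
    contDiffAt_const).congr_of_eventuallyEq (du_eventuallyEq hI hF ht)

lemma smooth_dt (hF : SmoothOnStrip I F) (hI : IsOpen I) : SmoothOnStrip I (dt F) :=
  fun u t ht => (((hF u t ht).fderiv_right (m := (⊤ : ℕ∞)) (by simp)).clm_apply
    contDiffAt_const).congr_of_eventuallyEq (dt_eventuallyEq hI hF ht)

lemma dt_du_comm (hF : SmoothOnStrip I F) (hI : IsOpen I) (ht : t ∈ I) :
    dt (du F) u t = du (dt F) u t := by
  have hd : DifferentiableAt ℝ (fderiv ℝ (Function.uncurry F)) (u, t) :=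
    ((hF u t ht).fderiv_right (m := 1) (by norm_cast)).differentiableAt (by simp)
  have h1 : dt (du F) u t = fderiv ℝ (Function.uncurry (du F)) (u, t) (0, 1) :=
    (hasDerivAt_snd_of_contDiffAt (smooth_du hF hI u t ht)).deriv
  have h2 : du (dt F) u t = fderiv ℝ (Function.uncurry (dt F)) (u, t) (1, 0) :=
    (hasDerivAt_fst_of_contDiffAt (smooth_dt hF hI u t ht)).deriv
  rw [h1, h2, (du_eventuallyEq hI hF ht).fderiv_eq, (dt_eventuallyEq hI hF ht).fderiv_eq,
    fderiv_clm_apply hd (differentiableAt_const _), fderiv_clm_apply hd (differentiableAt_const _)]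
  simpa using (hF u t ht).isSymmSndFDerivAt (by simp; norm_cast) (0, 1) (1, 0)

lemma mul (hf : SmoothOnStrip I f) (hh : SmoothOnStrip I h) :
    SmoothOnStrip I fun u t => f u t * h u t := fun u t ht => (hf u t ht).mul (hh u t ht)

lemma inv (hf : SmoothOnStrip I f) (hne : ∀ u, ∀ t ∈ I, f u t ≠ 0) :
    SmoothOnStrip I fun u t => (f u t)⁻¹ := fun u t ht => (hf u t ht).inv (hne u t ht)

lemma comp {φ : ℝ → ℝ} (hφ : ContDiff ℝ (⊤ : ℕ∞) φ) (hf : SmoothOnStrip I f) :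
    SmoothOnStrip I fun u t => φ (f u t) :=
  fun u t ht => hφ.contDiffAt.comp (u, t) (hf u t ht)

lemma continuous_slice (hF : SmoothOnStrip I F) (ht : t ∈ I) : Continuous fun u => F u t :=
  continuous_iff_continuousAt.2 fun _ => (hF.hasDerivAt_du ht).continuousAt

lemma continuousOn (hF : SmoothOnStrip I F) :
    ContinuousOn (Function.uncurry F) (Set.univ ×ˢ I) :=
  fun p hp => (hF p.1 p.2 hp.2).continuousAt.continuousWithinAt

lemma hasDerivAt_integral (hF : SmoothOnStrip I F) (hI : IsOpen I) (ht : t ∈ I) (a b : ℝ) :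
    HasDerivAt (fun t' => ∫ u in a..b, F u t') (∫ u in a..b, dt F u t) t := by
  obtain ⟨ε, hε, hball⟩ := Metric.nhds_basis_closedBall.mem_iff.1 (hI.mem_nhds ht)
  have hdt := hF.smooth_dt hI
  obtain ⟨C, hC⟩ := (isCompact_uIcc (a := a) (b := b)).prod (isCompact_closedBall t ε)
    |>.exists_bound_of_continuousOn (f := Function.uncurry (dt F))
      (hdt.continuousOn.mono (Set.prod_mono (Set.subset_univ _) hball))
  refine (intervalIntegral.hasDerivAt_integral_of_dominated_loc_of_deriv_le
    (F := fun t u => F u t) (F' := fun t u => dt F u t) (bound := fun _ => C)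
    (Metric.closedBall_mem_nhds t hε) ?_ ((hF.continuous_slice ht).intervalIntegrable _ _)
    (hdt.continuous_slice ht).aestronglyMeasurable ?_ intervalIntegrable_const ?_).2
  · filter_upwards [hI.mem_nhds ht] with t' ht'
    exact (hF.continuous_slice ht').aestronglyMeasurable
  · exact .of_forall fun u hu t' ht' => hC (u, t') ⟨Set.uIoc_subset_uIcc hu, ht'⟩
  · exact .of_forall fun u _ t' ht' => hF.hasDerivAt_dt (hball ht')

end SmoothOnStrip

end PartialDerivatives

lemma HasDerivAt.eq_of_eqOn {I : Set ℝ} {f h : ℝ → ℝ} {f' h' t : ℝ} (hf : HasDerivAt f f' t)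
    (hh : HasDerivAt h h' t) (hI : IsOpen I) (ht : t ∈ I) (hfh : ∀ t ∈ I, f t = h t) : f' = h' :=
  hf.unique (hh.congr_of_eventuallyEq (by filter_upwards [hI.mem_nhds ht] using hfh))

lemma HasDerivAt.eq_of_forall_eq {f h : ℝ → ℝ} {f' h' t : ℝ} (hf : HasDerivAt f f' t)
    (hh : HasDerivAt h h' t) (hfh : ∀ t, f t = h t) : f' = h' :=
  hf.unique (funext hfh ▸ hh)

section CurveEvolution

variable {I : Set ℝ} {p q a b g k α β : ℝ → ℝ → ℝ}

/-- Evolution of local length and curvature for a curve `(p, q)` with unit tangent `(a, b)`. -/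
lemma evolution_local_length_curvature (hI : IsOpen I)
    (hp : SmoothOnStrip I p) (hq : SmoothOnStrip I q) (ha : SmoothOnStrip I a)
    (hb : SmoothOnStrip I b) (hg : SmoothOnStrip I g) (hk : SmoothOnStrip I k)
    (hα : SmoothOnStrip I α) (hβ : SmoothOnStrip I β)
    (hg0 : ∀ u, ∀ t ∈ I, g u t ≠ 0)
    (hab : ∀ u, ∀ t ∈ I, a u t * a u t + b u t * b u t = 1)
    (hpu : ∀ u, ∀ t ∈ I, du p u t = g u t * a u t)
    (hqu : ∀ u, ∀ t ∈ I, du q u t = g u t * b u t)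
    (hau : ∀ u, ∀ t ∈ I, du a u t = -(g u t * k u t * b u t))
    (hbu : ∀ u, ∀ t ∈ I, du b u t = g u t * k u t * a u t)
    (hpt : ∀ u, ∀ t ∈ I, dt p u t = -(β u t * b u t) + α u t * a u t)
    (hqt : ∀ u, ∀ t ∈ I, dt q u t = β u t * a u t + α u t * b u t)
    {u t : ℝ} (ht : t ∈ I) :
    dt g u t = du α u t - g u t * k u t * β u t ∧
    g u t * dt k u t = du (fun u t => (g u t)⁻¹ * du β u t) u t + α u t * du k u t
      + g u t * k u t ^ 2 * β u t := by
  have htang : ∀ u, ∀ t ∈ I, dt g u t = du α u t - g u t * k u t * β u t ∧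
      dt a u t = -(((g u t)⁻¹ * du β u t + α u t * k u t) * b u t) ∧
      dt b u t = ((g u t)⁻¹ * du β u t + α u t * k u t) * a u t := by
    intro u t ht
    have e1 : dt g u t * a u t + g u t * dt a u t
        = -(du β u t * b u t + β u t * du b u t) + (du α u t * a u t + α u t * du a u t) := by
      have h1 := ((hp.smooth_du hI).hasDerivAt_dt ht).eq_of_eqOn
          (((hg.hasDerivAt_dt ht).fun_mul (ha.hasDerivAt_dt ht)))
          hI ht (hpu u)
      have h2 := ((hp.smooth_dt hI).hasDerivAt_du (u := u) ht).eq_of_forall_eq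
          ((((hβ.hasDerivAt_du ht).fun_mul (hb.hasDerivAt_du ht)).fun_neg.add
            ((hα.hasDerivAt_du ht).fun_mul (ha.hasDerivAt_du ht))))
          fun u => hpt u t ht
      exact h1.symm.trans ((hp.dt_du_comm hI ht).trans h2)
    have e2 : dt g u t * b u t + g u t * dt b u t
        = (du β u t * a u t + β u t * du a u t) + (du α u t * b u t + α u t * du b u t) := by
      have h1 := ((hq.smooth_du hI).hasDerivAt_dt ht).eq_of_eqOn
          (((hg.hasDerivAt_dt ht).fun_mul (hb.hasDerivAt_dt ht)))
          hI ht (hqu u)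
      have h2 := ((hq.smooth_dt hI).hasDerivAt_du (u := u) ht).eq_of_forall_eq
          ((((hβ.hasDerivAt_du ht).fun_mul (ha.hasDerivAt_du ht)).add
            ((hα.hasDerivAt_du ht).fun_mul (hb.hasDerivAt_du ht))))
          fun u => hqt u t ht
      exact h1.symm.trans ((hq.dt_du_comm hI ht).trans h2)
    have e3 : (dt a u t * a u t + a u t * dt a u t) + (dt b u t * b u t + b u t * dt b u t) = 0 :=
      (((ha.hasDerivAt_dt ht).fun_mul (ha.hasDerivAt_dt ht)).fun_add
        ((hb.hasDerivAt_dt ht).fun_mul (hb.hasDerivAt_dt ht))).eq_of_eqOn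
        (hasDerivAt_const t 1) hI ht (hab u)
    rw [hau u t ht, hbu u t ht] at e1 e2
    have e4 := hab u t ht
    have hgt := hg0 u t ht
    have e5 : dt g u t = du α u t - g u t * k u t * β u t := by
      linear_combination a u t * e1 + b u t * e2 - g u t / 2 * e3
        + (-dt g u t + du α u t - g u t * k u t * β u t) * e4
    refine ⟨e5, ?_, ?_⟩
    · field_simp
      linear_combination e1 - a u t * e5
    · field_simp
      linear_combination e2 - b u t * e5
  refine ⟨(htang u t ht).1, ?_⟩
  have hσ : SmoothOnStrip I fun u t => (g u t)⁻¹ * du β u t :=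
    (hg.inv hg0).mul (hβ.smooth_du hI)
  obtain ⟨hgt, hat, hbt⟩ := htang u t ht
  have e1 : -((dt g u t * k u t + g u t * dt k u t) * b u t + g u t * k u t * dt b u t)
      = -((du (fun u t => (g u t)⁻¹ * du β u t) u t + (du α u t * k u t + α u t * du k u t))
        * b u t + ((g u t)⁻¹ * du β u t + α u t * k u t) * du b u t) := by
    have h1 := ((ha.smooth_du hI).hasDerivAt_dt ht).eq_of_eqOn
        ((((hg.hasDerivAt_dt ht).fun_mul (hk.hasDerivAt_dt ht)).fun_mul
          (hb.hasDerivAt_dt ht)).fun_neg)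
        hI ht (hau u)
    have h2 := ((ha.smooth_dt hI).hasDerivAt_du (u := u) ht).eq_of_forall_eq
        ((((hσ.hasDerivAt_du ht).fun_add ((hα.hasDerivAt_du ht).fun_mul (hk.hasDerivAt_du ht))).mul
          (hb.hasDerivAt_du ht)).fun_neg)
        fun u => (htang u t ht).2.1
    exact h1.symm.trans ((ha.dt_du_comm hI ht).trans h2)
  have e2 : (dt g u t * k u t + g u t * dt k u t) * a u t + g u t * k u t * dt a u t
      = (du (fun u t => (g u t)⁻¹ * du β u t) u t + (du α u t * k u t + α u t * du k u t))
        * a u t + ((g u t)⁻¹ * du β u t + α u t * k u t) * du a u t := by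
    have h1 := ((hb.smooth_du hI).hasDerivAt_dt ht).eq_of_eqOn
        ((((hg.hasDerivAt_dt ht).fun_mul (hk.hasDerivAt_dt ht)).fun_mul (ha.hasDerivAt_dt ht)))
        hI ht (hbu u)
    have h2 := ((hb.smooth_dt hI).hasDerivAt_du (u := u) ht).eq_of_forall_eq
        ((((hσ.hasDerivAt_du ht).fun_add ((hα.hasDerivAt_du ht).fun_mul (hk.hasDerivAt_du ht))).mul
          (ha.hasDerivAt_du ht)))
        fun u => (htang u t ht).2.2
    exact h1.symm.trans ((hb.dt_du_comm hI ht).trans h2)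
  rw [hat, hau u t ht] at e2
  rw [hbt, hbu u t ht] at e1
  have e4 := hab u t ht
  generalize du (fun u t => (g u t)⁻¹ * du β u t) u t = σ at *
  linear_combination a u t * e2 - b u t * e1 - k u t * hgt
    - ((dt g u t * k u t + g u t * dt k u t) - (σ + (du α u t * k u t + α u t * du k u t))) * e4

end CurveEvolution

/-- Solutions of `r' = ω (1 - r)` tend to `1` when the integral of `ω` diverges. -/
lemma tendsto_one_of_relaxation {I : Set ℝ} (hI : IsOpen I) (hIc : IsPreconnected I)
    {l : Filter ℝ} (hl : ∀ᶠ t in l, t ∈ I) {ω W r : ℝ → ℝ}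
    (hW : ∀ t ∈ I, HasDerivAt W (ω t) t) (hr : ∀ t ∈ I, HasDerivAt r (ω t * (1 - r t)) t)
    (hdiv : Tendsto W l atTop) : Tendsto r l (nhds 1) := by
  have hd : ∀ t ∈ I, HasDerivAt (fun t => (r t - 1) * Real.exp (W t)) 0 t := fun t ht => by
    convert! ((hr t ht).sub_const 1).mul (hW t ht).exp using 1
    ring
  obtain ⟨C, hC⟩ := hI.exists_is_const_of_deriv_eq_zero hIc
    (fun t ht => (hd t ht).differentiableAt.differentiableWithinAt) fun t ht => (hd t ht).deriv
  have hlim : Tendsto (fun t => 1 + C * Real.exp (-W t)) l (nhds (1 + C * 0)) :=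
    ((Real.tendsto_exp_neg_atTop_nhds_zero.comp hdiv).const_mul C).const_add 1
  rw [mul_zero, add_zero] at hlim
  refine hlim.congr' ?_
  filter_upwards [hl] with t ht
  rw [← hC t ht, mul_assoc, ← Real.exp_add]
  simp

namespace SmoothOnStrip

variable {I : Set ℝ} {F : ℝ → ℝ → ℝ × ℝ} {u t : ℝ}

lemma fst (hF : SmoothOnStrip I F) : SmoothOnStrip I fun u t => (F u t).1 :=
  fun u t ht => contDiffAt_fst.comp (u, t) (hF u t ht)

lemma snd (hF : SmoothOnStrip I F) : SmoothOnStrip I fun u t => (F u t).2 :=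
  fun u t ht => contDiffAt_snd.comp (u, t) (hF u t ht)

lemma du_fst (hF : SmoothOnStrip I F) (ht : t ∈ I) :
    du (fun u t => (F u t).1) u t = (du F u t).1 :=
  ((ContinuousLinearMap.fst ℝ ℝ ℝ).hasFDerivAt.comp_hasDerivAt u
    (hF.hasDerivAt_du (u := u) ht)).deriv

lemma du_snd (hF : SmoothOnStrip I F) (ht : t ∈ I) :
    du (fun u t => (F u t).2) u t = (du F u t).2 :=
  ((ContinuousLinearMap.snd ℝ ℝ ℝ).hasFDerivAt.comp_hasDerivAt u
    (hF.hasDerivAt_du (u := u) ht)).deriv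

lemma dt_fst (hF : SmoothOnStrip I F) (ht : t ∈ I) :
    dt (fun u t => (F u t).1) u t = (dt F u t).1 :=
  ((ContinuousLinearMap.fst ℝ ℝ ℝ).hasFDerivAt.comp_hasDerivAt t
    (hF.hasDerivAt_dt (u := u) ht)).deriv

lemma dt_snd (hF : SmoothOnStrip I F) (ht : t ∈ I) :
    dt (fun u t => (F u t).2) u t = (dt F u t).2 :=
  ((ContinuousLinearMap.snd ℝ ℝ ℝ).hasFDerivAt.comp_hasDerivAt t
    (hF.hasDerivAt_dt (u := u) ht)).deriv

lemma smooth_gl (hF : SmoothOnStrip I F) (hI : IsOpen I) (hg : ∀ u, ∀ t ∈ I, 0 < gl F u t) :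
    SmoothOnStrip I (gl F) := fun u t ht => by
  have hd := hF.smooth_du hI
  exact (((hd.fst u t ht).pow 2).add ((hd.snd u t ht).pow 2)).sqrt
    (Real.sqrt_pos.1 (hg u t ht)).ne'

lemma smooth_tang (hF : SmoothOnStrip I F) (hI : IsOpen I) (hg : ∀ u, ∀ t ∈ I, 0 < gl F u t) :
    SmoothOnStrip I (tang F) := fun u t ht =>
  ((hF.smooth_gl hI hg).inv (fun u t ht => (hg u t ht).ne') u t ht).smul (hF.smooth_du hI u t ht)

end SmoothOnStrip

lemma tang_sq_add_sq {x : ℝ → ℝ → ℝ × ℝ} {u t : ℝ} (hg : 0 < gl x u t) :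
    (tang x u t).1 * (tang x u t).1 + (tang x u t).2 * (tang x u t).2 = 1 := by
  have h := Real.sq_sqrt (Real.sqrt_pos.1 hg).le
  change gl x u t ^ 2 = _ at h
  simp only [tang, Prod.smul_fst, Prod.smul_snd, smul_eq_mul]
  field_simp
  linarith

lemma gl_smul_tang {x : ℝ → ℝ → ℝ × ℝ} {u t : ℝ} (hg : 0 < gl x u t) :
    du x u t = gl x u t • tang x u t :=
  (smul_inv_smul₀ hg.ne' _).symm

/-- Evolution of the weighted local length `g φ(k)` under the motion law. -/
lemma dt_weighted_length {I : Set ℝ} (hI : IsOpen I) {x : ℝ → ℝ → ℝ × ℝ} {β α k : ℝ → ℝ → ℝ}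
    (hx : SmoothOnStrip I x) (hβ : SmoothOnStrip I β) (hα : SmoothOnStrip I α)
    (hk : SmoothOnStrip I k) (hg : ∀ u, ∀ t ∈ I, 0 < gl x u t)
    (hfrenet : ∀ u, ∀ t ∈ I, du (tang x) u t = (gl x u t * k u t) • nor x u t)
    (hmotion : ∀ u, ∀ t ∈ I, dt x u t = β u t • nor x u t + α u t • tang x u t)
    {φ : ℝ → ℝ} (hφ : ContDiff ℝ (⊤ : ℕ∞) φ) {u t : ℝ} (ht : t ∈ I) :
    dt (fun u t => gl x u t * φ (k u t)) u t
      = gl x u t * sder x (fun u t => φ (k u t) * α u t) u t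
        - gl x u t * fphi x φ k β u t := by
  have hgl := hx.smooth_gl hI hg
  have hT := hx.smooth_tang hI hg
  have hne : ∀ u, ∀ t ∈ I, gl x u t ≠ 0 := fun u t ht => (hg u t ht).ne'
  obtain ⟨hgt, hkt⟩ := evolution_local_length_curvature hI hx.fst hx.snd hT.fst hT.snd hgl hk hα hβ
    hne (fun u t ht => tang_sq_add_sq (hg u t ht))
    (fun u t ht => by rw [hx.du_fst ht, gl_smul_tang (hg u t ht)]; rfl)
    (fun u t ht => by rw [hx.du_snd ht, gl_smul_tang (hg u t ht)]; rfl)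
    (fun u t ht => by rw [hT.du_fst ht, hfrenet u t ht]; simp [nor, rot])
    (fun u t ht => by rw [hT.du_snd ht, hfrenet u t ht]; simp [nor, rot])
    (fun u t ht => by rw [hx.dt_fst ht, hmotion u t ht]; simp [nor, rot])
    (fun u t ht => by rw [hx.dt_snd ht, hmotion u t ht]; simp [nor, rot]) (u := u) ht
  have hφ' : HasDerivAt φ (deriv φ (k u t)) (k u t) :=
    (hφ.differentiable (by simp) _).hasDerivAt
  have h1 : dt (fun u t => gl x u t * φ (k u t)) u t
      = dt (gl x) u t * φ (k u t) + gl x u t * (deriv φ (k u t) * dt k u t) :=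
    ((hgl.hasDerivAt_dt ht).fun_mul
      (hφ'.comp t (hk.hasDerivAt_dt (u := u) ht))).deriv
  have h2 : deriv (fun u' => φ (k u' t) * α u' t) u
      = deriv φ (k u t) * du k u t * α u t + φ (k u t) * du α u t :=
    ((hφ'.comp u (hk.hasDerivAt_du ht)).fun_mul (hα.hasDerivAt_du ht)).deriv
  have h3 : gl x u t * sder x (sder x β) u t
      = du (fun u t => (gl x u t)⁻¹ * du β u t) u t := mul_inv_cancel_left₀ (hne u t ht) _
  have h4 : gl x u t * sder x (fun u t => φ (k u t) * α u t) u t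
      = deriv φ (k u t) * du k u t * α u t + φ (k u t) * du α u t :=
    (mul_inv_cancel_left₀ (hne u t ht) _).trans h2
  rw [← h3] at hkt
  rw [h1, h4, fphi]
  linear_combination φ (k u t) * hgt + deriv φ (k u t) * hkt

lemma isOpen_Ioo_ereal (T : EReal) : IsOpen {t : ℝ | 0 < t ∧ (t : EReal) < T} :=
  (isOpen_lt continuous_const continuous_id).inter
    (isOpen_lt continuous_coe_real_ereal continuous_const)

lemma isPreconnected_Ioo_ereal (T : EReal) :
    IsPreconnected {t : ℝ | 0 < t ∧ (t : EReal) < T} :=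
  Set.OrdConnected.isPreconnected ⟨fun _ hs _ ht _ hr =>
    ⟨hs.1.trans_le hr.1, (EReal.coe_le_coe_iff.2 hr.2).trans_lt ht.2⟩⟩

lemma eventually_toTime {T : EReal} (hT : 0 < T) :
    ∀ᶠ t : ℝ in toTime T, 0 < t ∧ (t : EReal) < T := by
  have h : ∀ᶠ s : EReal in nhdsWithin T (Set.Iio T), 0 < s ∧ s < T :=
    (eventually_nhdsWithin_of_eventually_nhds (lt_mem_nhds hT)).and self_mem_nhdsWithin
  exact (h.comap _).mono fun t ht => ⟨EReal.coe_pos.1 ht.1, ht.2⟩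

lemma hasDerivAt_integral_of_continuousOn_timeDom {T : EReal} {ω : ℝ → ℝ}
    (hω : ContinuousOn ω (timeDom T)) {t : ℝ} (ht : 0 < t ∧ (t : EReal) < T) :
    HasDerivAt (fun t => ∫ τ in (0:ℝ)..t, ω τ) (ω t) t := by
  have hopen := isOpen_Ioo_ereal T
  have hω' : ContinuousOn ω {t : ℝ | 0 < t ∧ (t : EReal) < T} :=
    hω.mono fun s hs => ⟨hs.1.le, hs.2⟩
  refine intervalIntegral.integral_hasDerivAt_right ?_
    (hω'.stronglyMeasurableAtFilter hopen t ht) (hω'.continuousAt (hopen.mem_nhds ht))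
  refine (hω.mono fun s hs => ?_).intervalIntegrable
  rw [Set.uIcc_of_le ht.1.le] at hs
  exact ⟨hs.1, (EReal.coe_le_coe_iff.2 hs.2).trans_lt ht.2⟩

/-- Asymptotic curvature adjusted redistribution: if the tangential
velocity `α` satisfies `∂_s(φ(k)α)/φ(k) = f/φ(k) − ⟨f⟩/⟨φ(k)⟩ + ω(t)(r_φ⁻¹ − 1)`, with
`f = φ(k) k β − (∂_s²β + k²β) φ'(k)`, the function `ω` is nonnegative, and
`∫₀ᵗ ω(τ) dτ → ∞` as `t → T`, then for every parameter value `u` the extended relative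
local length converges: `r_φ(u,t) → 1` as `t → T`. -/
theorem asymptotic_redistribution
    (Tmax : EReal) (hTmax : 0 < Tmax)
    (x : ℝ → ℝ → ℝ × ℝ) (β α k : ℝ → ℝ → ℝ)
    (hx : ContDiff ℝ (⊤ : ℕ∞) (Function.uncurry x))
    (hβ : ContDiff ℝ (⊤ : ℕ∞) (Function.uncurry β))
    (hα : ContDiff ℝ (⊤ : ℕ∞) (Function.uncurry α))
    (hk : ContDiff ℝ (⊤ : ℕ∞) (Function.uncurry k))
    (hxper : ∀ t : ℝ, Function.Periodic (fun u => x u t) 1)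
    (hg : ∀ (u t : ℝ), t ∈ timeDom Tmax → 0 < gl x u t)
    (hfrenet : ∀ (u t : ℝ), t ∈ timeDom Tmax →
      deriv (fun u' => tang x u' t) u = (gl x u t * k u t) • nor x u t)
    (hmotion : ∀ (u t : ℝ), t ∈ timeDom Tmax →
      deriv (fun t' => x u t') t = β u t • nor x u t + α u t • tang x u t)
    (φ : ℝ → ℝ) (hφ : ContDiff ℝ (⊤ : ℕ∞) φ) (hφpos : ∀ s : ℝ, 0 < φ s)
    (hαper : ∀ t : ℝ, Function.Periodic (fun u => α u t) 1)
    (hβper : ∀ t : ℝ, Function.Periodic (fun u => β u t) 1)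
    (ω : ℝ → ℝ) (hωcont : ContinuousOn ω (timeDom Tmax))
    (hωpos : ∀ t ∈ timeDom Tmax, 0 ≤ ω t)
    (halpha : ∀ (u t : ℝ), t ∈ timeDom Tmax →
      sder x (fun u' t' => φ (k u' t') * α u' t') u t / φ (k u t)
        = fphi x φ k β u t / φ (k u t)
          - avg x (fphi x φ k β) t / avg x (fun u' t' => φ (k u' t')) t
          + ω t * ((rphi x φ k u t)⁻¹ - 1))
    (hdiv : Filter.Tendsto (fun t => ∫ τ in (0:ℝ)..t, ω τ) (toTime Tmax) Filter.atTop) :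
    ∀ u : ℝ, Filter.Tendsto (fun t => rphi x φ k u t) (toTime Tmax) (nhds 1) := by
  set I : Set ℝ := {t : ℝ | 0 < t ∧ (t : EReal) < Tmax} with hIdef
  have hI : IsOpen I := isOpen_Ioo_ereal Tmax
  have hdom : ∀ t ∈ I, t ∈ timeDom Tmax := fun t ht => ⟨ht.1.le, ht.2⟩
  have hgI : ∀ u, ∀ t ∈ I, 0 < gl x u t := fun u t ht => hg u t (hdom t ht)
  have hgl : SmoothOnStrip I (gl x) := hx.smoothOnStrip.smooth_gl hI hgI
  set G : ℝ → ℝ → ℝ := fun u t => gl x u t * φ (k u t) with hGdef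
  have hG : SmoothOnStrip I G := hgl.mul (hk.smoothOnStrip.comp hφ)
  have hGpos : ∀ u, ∀ t ∈ I, 0 < G u t := fun u t ht => mul_pos (hgI u t ht) (hφpos _)
  set P : ℝ → ℝ := fun t => ∫ u in (0:ℝ)..1, G u t with hPdef
  have hPpos : ∀ t ∈ I, 0 < P t := fun t ht =>
    intervalIntegral.intervalIntegral_pos_of_pos
      ((hG.continuous_slice ht).intervalIntegrable _ _) (fun u => hGpos u t ht) one_pos
  have hr : ∀ u, ∀ t ∈ I, rphi x φ k u t = G u t / P t := fun u t ht => by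
    have hL : 0 < len x t := intervalIntegral.intervalIntegral_pos_of_pos
      ((hgl.continuous_slice ht).intervalIntegrable _ _) (fun u => hgI u t ht) one_pos
    simp only [rphi, avg, mul_inv_cancel_left₀ hL.ne', hPdef, hGdef, mul_comm (φ _)]
  set c : ℝ → ℝ := fun t => avg x (fphi x φ k β) t / avg x (fun u' t' => φ (k u' t')) t
  have hGt : ∀ u, ∀ t ∈ I, dt G u t = -(c t * G u t) + ω t * (P t - G u t) := fun u t ht => by
    have h := dt_weighted_length hI hx.smoothOnStrip hβ.smoothOnStrip hα.smoothOnStrip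
      hk.smoothOnStrip hgI (fun u t ht => hfrenet u t (hdom t ht))
      (fun u t ht => hmotion u t (hdom t ht)) hφ (u := u) ht
    have ha := halpha u t (hdom t ht)
    rw [hr u t ht] at ha
    have hφ0 := (hφpos (k u t)).ne'
    have hg0 := (hgI u t ht).ne'
    have hG0 := (hGpos u t ht).ne'
    have hP0 := (hPpos t ht).ne'
    refine h.trans ?_
    have ha' := congrArg (G u t * ·) ha
    have e1 : ∀ y, G u t * (y / φ (k u t)) = gl x u t * y := fun y => by
      simp only [hGdef]; field_simp
    have e2 : G u t * (ω t * ((G u t / P t)⁻¹ - 1)) = ω t * (P t - G u t) := by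
      field_simp
    simp only [mul_add, mul_sub, e1] at ha' e2 ⊢
    linear_combination ha' + e2
  have hPt : ∀ t ∈ I, HasDerivAt P (-(c t * P t)) t := fun t ht => by
    have hGi : IntervalIntegrable (fun u => G u t) MeasureTheory.volume 0 1 :=
      (hG.continuous_slice ht).intervalIntegrable _ _
    have hGn : IntervalIntegrable (fun u => -(c t * G u t)) MeasureTheory.volume 0 1 :=
      (hGi.const_mul _).neg
    convert! hG.hasDerivAt_integral hI ht 0 1 using 1
    simp_rw [hGt _ t ht]
    rw [intervalIntegral.integral_add hGn
        ((intervalIntegrable_const.sub hGi).const_mul _),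
      intervalIntegral.integral_neg, intervalIntegral.integral_const_mul,
      intervalIntegral.integral_const_mul,
      intervalIntegral.integral_sub intervalIntegrable_const hGi]
    simp [hPdef]
  intro u
  refine tendsto_one_of_relaxation hI (isPreconnected_Ioo_ereal Tmax) (eventually_toTime hTmax)
    (fun t ht => hasDerivAt_integral_of_continuousOn_timeDom hωcont ht) (fun t ht => ?_) hdiv
  have hP0 := (hPpos t ht).ne'
  have hd := ((hG.hasDerivAt_dt (u := u) ht).fun_div (hPt t ht) hP0).congr_of_eventuallyEq
    (f₁ := fun t => rphi x φ k u t) (by filter_upwards [hI.mem_nhds ht] using hr u)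
  convert! hd using 1
  rw [hr u t ht, hGt u t ht]
  field_simp
  ring
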